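/- Let G be a simple graph with a matching M and let S be a set of M-unmatched vertices. If x and y are two distinct vertices that are both tough at time n, then their families are disjoint: F_n(x) ∩ F_n(y) = ∅. -/

import Mathlib

open scoped Classical

namespace PaperPM

variable {V : Type*}

/-- A vertex is matched by the edge set `M` if some edge of `M` contains it. -/
def Matched (M : Set (Sym2 V)) (v : V) : Prop := ∃ e ∈ M, v ∈ e

/-- `M` is a matching in `G`: a set of edges of `G`, no two sharing a vertex. -/
def IsMatching (G : SimpleGraph V) (M : Set (Sym2 V)) : Prop :=
  M ⊆ G.edgeSet ∧ ∀ e ∈ M, ∀ f ∈ M, ∀ v : V, v ∈ e → v ∈ f → e = f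

/-- `p` is an alternating path w.r.t. the matching `M`: a path in `G` (consecutive
vertices adjacent, no repeated vertices) whose first edge is not in `M` and whose
edges lie alternately outside and inside `M`. -/
def IsAltPath (G : SimpleGraph V) (M : Set (Sym2 V)) (p : List V) : Prop :=
  p ≠ [] ∧ p.Chain' G.Adj ∧ p.Nodup ∧
    ∀ (i : ℕ) (h : i + 1 < p.length),
      (s(p[i]'(Nat.lt_of_succ_lt h), p[i + 1]'h) ∈ M ↔ i % 2 = 1)

/-- The length (number of edges) of a path given as a list of vertices. -/
def pathLen (p : List V) : ℕ := p.length - 1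

/-- An alternating path from `x` to `y`. -/
def IsAltPathFrom (G : SimpleGraph V) (M : Set (Sym2 V)) (x y : V) (p : List V) : Prop :=
  IsAltPath G M p ∧ p.head? = some x ∧ p.getLast? = some y

/-- An augmenting path from the set `S`: an alternating path of odd length starting at
a vertex of `S` and ending at an `M`-unmatched vertex. -/
def IsAugPathFrom (G : SimpleGraph V) (M : Set (Sym2 V)) (S : Set V) (p : List V) : Prop :=
  IsAltPath G M p ∧ Odd (pathLen p) ∧
    (∃ x ∈ S, p.head? = some x) ∧ ∃ y, p.getLast? = some y ∧ ¬ Matched M y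

/-- `H̃ n`: the vertices reachable from `S` by an odd alternating path of length at
most `2n`. -/
def Htilde (G : SimpleGraph V) (M : Set (Sym2 V)) (S : Set V) (n : ℕ) : Set V :=
  {v | ∃ x ∈ S, ∃ p : List V, IsAltPathFrom G M x v p ∧ Odd (pathLen p) ∧ pathLen p ≤ 2 * n}

/-- `T̃ n`: the vertices reachable from `S` by an even alternating path of length
between `2` and `2n`. -/
def Ttilde (G : SimpleGraph V) (M : Set (Sym2 V)) (S : Set V) (n : ℕ) : Set V :=
  {v | ∃ x ∈ S, ∃ p : List V, IsAltPathFrom G M x v p ∧ Even (pathLen p) ∧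
    2 ≤ pathLen p ∧ pathLen p ≤ 2 * n}

/-- `B n = H̃ n ∩ T̃ n`. -/
def Bset (G : SimpleGraph V) (M : Set (Sym2 V)) (S : Set V) (n : ℕ) : Set V :=
  Htilde G M S n ∩ Ttilde G M S n

/-- `T n = T̃ n \ H̃ n`. -/
def Tset (G : SimpleGraph V) (M : Set (Sym2 V)) (S : Set V) (n : ℕ) : Set V :=
  Ttilde G M S n \ Htilde G M S n

/-- `x` is tough at time `n`: `x ∈ T n ∪ S`, `x` has a neighbour in `B n`, and
`x ∉ H̃ (n+1)`. -/
def Tough (G : SimpleGraph V) (M : Set (Sym2 V)) (S : Set V) (n : ℕ) (x : V) : Prop :=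
  x ∈ Tset G M S n ∪ S ∧ (∃ y ∈ Bset G M S n, G.Adj x y) ∧ x ∉ Htilde G M S (n + 1)

/-- The age of `x` at time `n`: `n - min {k : x ∈ T k ∪ S}`. -/
noncomputable def age (G : SimpleGraph V) (M : Set (Sym2 V)) (S : Set V) (n : ℕ) (x : V) : ℕ :=
  n - sInf {k : ℕ | x ∈ Tset G M S k ∪ S}

/-- `D` has the descendent property with respect to `x` at time `n`: every `y ∈ D` is
joined to `x` by an odd alternating path `p` and an even alternating path `q`, both with
all vertices in `D ∪ {x}`, with `|p| + |q| ≤ 2·age(x) + 1`. -/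
def DescProp (G : SimpleGraph V) (M : Set (Sym2 V)) (S : Set V) (n : ℕ) (x : V)
    (D : Set V) : Prop :=
  ∀ y ∈ D, ∃ p q : List V,
    IsAltPathFrom G M x y p ∧ Odd (pathLen p) ∧
    IsAltPathFrom G M x y q ∧ Even (pathLen q) ∧
    (∀ u ∈ p, u ∈ insert x D) ∧ (∀ u ∈ q, u ∈ insert x D) ∧
    pathLen p + pathLen q ≤ 2 * age G M S n x + 1

/-- The family of `x` at time `n`: the union of all sets with the descendent property
with respect to `x` at time `n`. -/
def family (G : SimpleGraph V) (M : Set (Sym2 V)) (S : Set V) (n : ℕ) (x : V) : Set V :=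
  ⋃₀ {D : Set V | DescProp G M S n x D}

/-! Functional representation of alternating paths. -/

def Edg (G : SimpleGraph V) (M : Set (Sym2 V)) (k : ℕ) (u w : V) : Prop :=
  G.Adj u w ∧ (s(u, w) ∈ M ↔ k % 2 = 1)

theorem Edg.symm {G : SimpleGraph V} {M : Set (Sym2 V)} {k : ℕ} {u w : V}
    (h : Edg G M k u w) : Edg G M k w u := by
  refine ⟨h.1.symm, ?_⟩
  rw [Sym2.eq_swap]; exact h.2

theorem Edg.par {G : SimpleGraph V} {M : Set (Sym2 V)} {k k' : ℕ} {u w : V}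
    (h : Edg G M k u w) (hk : k % 2 = k' % 2) : Edg G M k' u w := by
  refine ⟨h.1, ?_⟩
  rw [h.2, hk]

def AP (G : SimpleGraph V) (M : Set (Sym2 V)) (f : ℕ → V) (l : ℕ) : Prop :=
  (∀ i j, i ≤ l → j ≤ l → f i = f j → i = j) ∧ ∀ i, i < l → Edg G M i (f i) (f (i + 1))

theorem AP.mono {G : SimpleGraph V} {M : Set (Sym2 V)} {f : ℕ → V} {l k : ℕ}
    (h : AP G M f l) (hk : k ≤ l) : AP G M f k :=
  ⟨fun i j hi hj => h.1 i j (hi.trans hk) (hj.trans hk), fun i hi => h.2 i (hi.trans_le hk)⟩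

theorem AP.triv (G : SimpleGraph V) (M : Set (Sym2 V)) (x : V) : AP G M (fun _ => x) 0 :=
  ⟨fun i j hi hj _ => by omega, fun i hi => by omega⟩

def cat (f : ℕ → V) (a : ℕ) (g : ℕ → V) (c : ℕ) : ℕ → V :=
  fun i => if i ≤ a then f i else g (c + (i - a))

theorem cat_le {f : ℕ → V} {a : ℕ} {g : ℕ → V} {c i : ℕ} (h : i ≤ a) : cat f a g c i = f i := by
  simp [cat, h]

theorem cat_ge {f : ℕ → V} {a : ℕ} {g : ℕ → V} {c i : ℕ} (hfg : f a = g c) (h : a ≤ i) :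
    cat f a g c i = g (c + (i - a)) := by
  unfold cat
  split_ifs with h'
  · have : i = a := by omega
    subst this; simpa using hfg
  · rfl

theorem AP.cat {G : SimpleGraph V} {M : Set (Sym2 V)} {f g : ℕ → V} {a c d : ℕ}
    (hf : AP G M f a) (hg : AP G M g d) (hcd : c ≤ d) (hfg : f a = g c)
    (hpar : a % 2 = c % 2) (hdis : ∀ i j, i ≤ a → c < j → j ≤ d → f i ≠ g j) :
    AP G M (cat f a g c) (a + (d - c)) := by
  constructor
  · intro i j hi hj h
    rcases le_or_gt i a with hia | hia <;> rcases le_or_gt j a with hja | hja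
    · rw [cat_le hia, cat_le hja] at h
      exact hf.1 i j hia hja h
    · rw [cat_le hia, cat_ge hfg hja.le] at h
      exact absurd h (hdis _ _ hia (by omega) (by omega))
    · rw [cat_ge hfg hia.le, cat_le hja] at h
      exact absurd h.symm (hdis _ _ hja (by omega) (by omega))
    · rw [cat_ge hfg hia.le, cat_ge hfg hja.le] at h
      have := hg.1 _ _ (by omega) (by omega) h
      omega
  · intro i hi
    rcases lt_or_ge i a with hia | hia
    · rw [cat_le hia.le, cat_le (by omega)]
      exact hf.2 i hia
    · rw [cat_ge hfg hia, cat_ge hfg (by omega)]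
      have := (hg.2 (c + (i - a)) (by omega)).par (k' := i) (by omega)
      rwa [show c + (i + 1 - a) = c + (i - a) + 1 by omega]

def jrev (f : ℕ → V) (a : ℕ) (g : ℕ → V) (c : ℕ) : ℕ → V :=
  fun i => if i ≤ a then f i else g (c - (i - a - 1))

theorem jrev_le {f : ℕ → V} {a : ℕ} {g : ℕ → V} {c i : ℕ} (h : i ≤ a) : jrev f a g c i = f i := by
  simp [jrev, h]

theorem jrev_gt {f : ℕ → V} {a : ℕ} {g : ℕ → V} {c i : ℕ} (h : a < i) :
    jrev f a g c i = g (c - (i - a - 1)) := by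
  simp [jrev, h]

theorem AP.jrev {G : SimpleGraph V} {M : Set (Sym2 V)} {f g : ℕ → V} {a c d : ℕ}
    (hf : AP G M f a) (hg : AP G M g c) (hcd : d ≤ c) (he : Edg G M a (f a) (g c))
    (hpar : a % 2 = c % 2) (hdis : ∀ i j, i ≤ a → d ≤ j → j ≤ c → f i ≠ g j) :
    AP G M (jrev f a g c) (a + 1 + (c - d)) := by
  constructor
  · intro i j hi hj h
    rcases le_or_gt i a with hia | hia <;> rcases le_or_gt j a with hja | hja
    · rw [jrev_le hia, jrev_le hja] at h
      exact hf.1 i j hia hja h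
    · rw [jrev_le hia, jrev_gt hja] at h
      exact absurd h (hdis _ _ hia (by omega) (by omega))
    · rw [jrev_gt hia, jrev_le hja] at h
      exact absurd h.symm (hdis _ _ hja (by omega) (by omega))
    · rw [jrev_gt hia, jrev_gt hja] at h
      have := hg.1 _ _ (by omega) (by omega) h
      omega
  · intro i hi
    rcases lt_trichotomy i a with hia | hia | hia
    · rw [jrev_le hia.le, jrev_le (by omega)]
      exact hf.2 i hia
    · subst hia
      rw [jrev_le le_rfl, jrev_gt (by omega)]
      simpa using he
    · rw [jrev_gt hia, jrev_gt (by omega)]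
      have := (hg.2 (c - (i - a)) (by omega)).symm.par (k' := i) (by omega)
      rwa [show c - (i - a) + 1 = c - (i - a - 1) by omega,
        show c - (i - a) = c - (i + 1 - a - 1) by omega] at this

def snoc (f : ℕ → V) (a : ℕ) (u : V) : ℕ → V := fun i => if i ≤ a then f i else u

theorem snoc_le {f : ℕ → V} {a : ℕ} {u : V} {i : ℕ} (h : i ≤ a) : snoc f a u i = f i := by
  simp [snoc, h]

theorem snoc_gt {f : ℕ → V} {a : ℕ} {u : V} {i : ℕ} (h : a < i) : snoc f a u i = u := by
  simp [snoc, h]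

theorem AP.snoc {G : SimpleGraph V} {M : Set (Sym2 V)} {f : ℕ → V} {a : ℕ} {u : V}
    (hf : AP G M f a) (he : Edg G M a (f a) u) (hu : ∀ i, i ≤ a → f i ≠ u) :
    AP G M (snoc f a u) (a + 1) := by
  constructor
  · intro i j hi hj h
    rcases le_or_gt i a with hia | hia <;> rcases le_or_gt j a with hja | hja
    · rw [snoc_le hia, snoc_le hja] at h
      exact hf.1 i j hia hja h
    · rw [snoc_le hia, snoc_gt hja] at h
      exact absurd h (hu _ hia)
    · rw [snoc_gt hia, snoc_le hja] at h
      exact absurd h.symm (hu _ hja)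
    · omega
  · intro i hi
    rcases lt_or_ge i a with hia | hia
    · rw [snoc_le hia.le, snoc_le (by omega)]
      exact hf.2 i hia
    · have : i = a := by omega
      subst this
      rw [snoc_le le_rfl, snoc_gt (by omega)]
      exact he

/-- alternating path from `S` to `v` -/
def SP (G : SimpleGraph V) (M : Set (Sym2 V)) (S : Set V) (f : ℕ → V) (l : ℕ) (v : V) : Prop :=
  AP G M f l ∧ f 0 ∈ S ∧ f l = v

/-- alternating path from `x` to `v` inside `D` (apart from `x`) -/
def XP (G : SimpleGraph V) (M : Set (Sym2 V)) (x : V) (D : Set V) (f : ℕ → V) (l : ℕ) (v : V) :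
    Prop :=
  AP G M f l ∧ f 0 = x ∧ f l = v ∧ ∀ i, 0 < i → i ≤ l → f i ∈ D

def Desc (G : SimpleGraph V) (M : Set (Sym2 V)) (x : V) (e N : ℕ) (D : Set V) : Prop :=
  ∀ y ∈ D, ∃ p a q b, XP G M x D p a y ∧ XP G M x D q b y ∧ a % 2 = 1 ∧ b % 2 = 0 ∧ e + a + b ≤ N

def Fam (G : SimpleGraph V) (M : Set (Sym2 V)) (x : V) (e N : ℕ) : Set V :=
  ⋃₀ {D : Set V | Desc G M x e N D}

theorem XP.mono {G : SimpleGraph V} {M : Set (Sym2 V)} {x v : V} {D D' : Set V} {f : ℕ → V} {l : ℕ}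
    (h : XP G M x D f l v) (hD : D ⊆ D') : XP G M x D' f l v :=
  ⟨h.1, h.2.1, h.2.2.1, fun i h0 hi => hD (h.2.2.2 i h0 hi)⟩

theorem XP.triv (G : SimpleGraph V) (M : Set (Sym2 V)) (x : V) (D : Set V) :
    XP G M x D (fun _ => x) 0 x :=
  ⟨AP.triv G M x, rfl, rfl, fun i h0 hi => by omega⟩

theorem XP.pre {G : SimpleGraph V} {M : Set (Sym2 V)} {x v : V} {D : Set V} {f : ℕ → V} {l k : ℕ}
    (h : XP G M x D f l v) (hk : k ≤ l) : XP G M x D f k (f k) :=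
  ⟨h.1.mono hk, h.2.1, rfl, fun i h0 hi => h.2.2.2 i h0 (hi.trans hk)⟩

theorem SP.pre {G : SimpleGraph V} {M : Set (Sym2 V)} {S : Set V} {v : V} {f : ℕ → V} {l k : ℕ}
    (h : SP G M S f l v) (hk : k ≤ l) : SP G M S f k (f k) :=
  ⟨h.1.mono hk, h.2.1, rfl⟩

theorem XP.mem {G : SimpleGraph V} {M : Set (Sym2 V)} {x v : V} {D : Set V} {f : ℕ → V} {l i : ℕ}
    (h : XP G M x D f l v) (hk : i ≤ l) : f i = x ∨ f i ∈ D := by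
  rcases Nat.eq_zero_or_pos i with h0 | h0
  · left; rw [h0]; exact h.2.1
  · right; exact h.2.2.2 i h0 hk

theorem Desc.fam (G : SimpleGraph V) (M : Set (Sym2 V)) (x : V) (e N : ℕ) :
    Desc G M x e N (Fam G M x e N) := by
  rintro y ⟨D, hD, hy⟩
  obtain ⟨p, a, q, b, hp, hq, h⟩ := hD y hy
  have : D ⊆ Fam G M x e N := Set.subset_sUnion_of_mem hD
  exact ⟨p, a, q, b, hp.mono this, hq.mono this, h⟩

theorem Desc.sub {G : SimpleGraph V} {M : Set (Sym2 V)} {x : V} {e N : ℕ} {D : Set V}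
    (h : Desc G M x e N D) : D ⊆ Fam G M x e N := Set.subset_sUnion_of_mem h

theorem mate_uniq {G : SimpleGraph V} {M : Set (Sym2 V)} (hM : IsMatching G M) {u v w : V}
    (h1 : s(u, v) ∈ M) (h2 : s(u, w) ∈ M) : v = w := by
  have := hM.2 _ h1 _ h2 u (by simp) (by simp)
  exact Sym2.congr_right.1 this

section
variable {G : SimpleGraph V} {M : Set (Sym2 V)} {S : Set V} {x : V} {e N : ℕ}

theorem base_notMem : x ∉ Fam G M x e N := by
  intro h
  obtain ⟨p, a, q, b, hp, hq, ha, hb, hl⟩ := Desc.fam G M x e N x h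
  have := hp.1.1 0 a (by omega) le_rfl (by rw [hp.2.1, hp.2.2.1])
  omega

theorem fam_mate (hM : IsMatching G M) {v : V} (hv : v ∈ Fam G M x e N) :
    ∃ w ∈ Fam G M x e N, s(v, w) ∈ M := by
  obtain ⟨p, a, q, b, hp, hq, ha, hb, hl⟩ := Desc.fam G M x e N v hv
  have hb0 : b ≠ 0 := by
    rintro rfl
    have : v = x := by rw [← hq.2.2.1, hq.2.1]
    subst this
    exact base_notMem hv
  refine ⟨q (b - 1), hq.2.2.2 _ (by omega) (by omega), ?_⟩
  have := (hq.1.2 (b - 1) (by omega)).2.2 (by omega)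
  rw [show b - 1 + 1 = b by omega, hq.2.2.1] at this
  rwa [Sym2.eq_swap]

theorem fam_closed (hM : IsMatching G M) {v w : V} (hv : v ∈ Fam G M x e N) (hw : s(v, w) ∈ M) :
    w ∈ Fam G M x e N := by
  obtain ⟨w', h1, h2⟩ := fam_mate hM hv
  rwa [mate_uniq hM hw h2]

theorem fam_S (hM : IsMatching G M) (hS : ∀ v ∈ S, ¬ Matched M v) {v : V} (hv : v ∈ S) :
    v ∉ Fam G M x e N := by
  intro h
  obtain ⟨w', h1, h2⟩ := fam_mate hM h
  exact hS v hv ⟨_, h2, by simp⟩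

theorem entry (hM : IsMatching G M) {A : ℕ → V} {l i : ℕ} (hA : AP G M A l) (hi : i < l)
    (h1 : A i ∉ Fam G M x e N) (h2 : A (i + 1) ∈ Fam G M x e N) : i % 2 = 0 := by
  by_contra h
  have := (hA.2 i hi).2.2 (by omega)
  rw [Sym2.eq_swap] at this
  exact h1 (fam_closed hM h2 this)

theorem exit_ (hM : IsMatching G M) {A : ℕ → V} {l i : ℕ} (hA : AP G M A l) (hi : i < l)
    (h1 : A i ∈ Fam G M x e N) (h2 : A (i + 1) ∉ Fam G M x e N) : i % 2 = 0 := by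
  by_contra h
  have := (hA.2 i hi).2.2 (by omega)
  exact h2 (fam_closed hM h1 this)

structure Base (G : SimpleGraph V) (M : Set (Sym2 V)) (S : Set V) (x : V) (e N : ℕ) : Prop where
  ex : ∃ f, SP G M S f e x
  even : e % 2 = 0
  odd : N % 2 = 1
  min : ∀ f l, SP G M S f l x → l % 2 = 0 → e ≤ l
  far : ∀ f l, SP G M S f l x → l % 2 = 1 → N < l

theorem ear (hM : IsMatching G M) (hb : Base G M S x e N)
    {A : ℕ → V} {a : ℕ} {b u : V} (hA : SP G M S A a b) (ha : a % 2 = 0)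
    (hbF : b ∉ Fam G M x e N) (hbx : b ≠ x) (hu : u ∈ Fam G M x e N) (hE : Edg G M 0 b u)
    (hpre : ∀ i, i ≤ a → A i ∈ Fam G M x e N → i % 2 = 0 →
      ∃ q l, XP G M x (Fam G M x e N) q l (A i) ∧ l % 2 = 0 ∧ e + l ≤ i)
    {q : ℕ → V} {c : ℕ} (hq : XP G M x (Fam G M x e N) q c u) (hc : c % 2 = 0) :
    N < a + 1 + c := by
  by_contra hN
  set F := Fam G M x e N with hF
  by_cases hex : ∃ i, i ≤ a ∧ (A i = x ∨ A i ∈ F)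
  · obtain ⟨w, ⟨hwa, hw⟩, hwmax⟩ : ∃ w, (w ≤ a ∧ (A w = x ∨ A w ∈ F)) ∧
        ∀ j, w < j → j ≤ a → ¬ (A j = x ∨ A j ∈ F) := by
      obtain ⟨i, hi⟩ := hex
      refine ⟨Nat.findGreatest (fun i => i ≤ a ∧ (A i = x ∨ A i ∈ F)) a,
        Nat.findGreatest_spec (P := fun i => i ≤ a ∧ (A i = x ∨ A i ∈ F)) hi.1 hi, ?_⟩
      intro j hj hja hh
      exact Nat.findGreatest_is_greatest hj hja ⟨hja, hh⟩
    have hwa' : w < a := by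
      rcases hwa.lt_or_eq with h | h
      · exact h
      · subst h
        rw [hA.2.2] at hw
        tauto
    have hw2 : w % 2 = 0 ∧ ∃ qw l, XP G M x F qw l (A w) ∧ l % 2 = 0 ∧ e + l ≤ w := by
      rcases hw with hw | hw
      · have h0 : w % 2 = 0 := by
          by_contra h
          have := hb.far A w (hw ▸ hA.pre hwa) (by omega)
          omega
        refine ⟨h0, fun _ => x, 0, ?_, rfl, hb.min A w (hw ▸ hA.pre hwa) h0⟩
        rw [hw]; exact XP.triv G M x F
      · have h0 := exit_ hM hA.1 hwa' hw (fun h => hwmax (w + 1) (by omega) (by omega) (Or.inr h))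
        exact ⟨h0, hpre w hwa hw h0⟩
    obtain ⟨hw0, qw, lw, hqw, hlw, hle⟩ := hw2
    have hD : Desc G M x e N (F ∪ {g | ∃ j, w < j ∧ j ≤ a ∧ A j = g}) := by
      rintro g (hg | ⟨j, hwj, hja, rfl⟩)
      · obtain ⟨p, a, q, b, hp, hq, h⟩ := Desc.fam G M x e N g hg
        exact ⟨p, a, q, b, hp.mono Set.subset_union_left, hq.mono Set.subset_union_left, h⟩
      · have p1 : XP G M x (F ∪ {g | ∃ j, w < j ∧ j ≤ a ∧ A j = g}) (cat qw lw A w) (lw + (j - w))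
            (A j) := by
          refine ⟨hqw.1.cat (hA.1.mono hja) hwj.le hqw.2.2.1 (by omega) ?_, ?_, ?_, ?_⟩
          · intro i k hi hk1 hk2 h
            have := hqw.mem hi
            rw [h] at this
            exact hwmax k hk1 (by omega) this
          · rw [cat_le (by omega)]; exact hqw.2.1
          · rw [cat_ge hqw.2.2.1 (by omega)]; congr 1; omega
          · intro i h0 hi
            rcases le_or_gt i lw with h | h
            · rw [cat_le h]; exact Or.inl (hqw.2.2.2 i h0 h)
            · rw [cat_ge hqw.2.2.1 h.le]
              exact Or.inr ⟨_, by omega, by omega, rfl⟩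
        have p2 : XP G M x (F ∪ {g | ∃ j, w < j ∧ j ≤ a ∧ A j = g}) (jrev q c A a) (c + 1 + (a - j))
            (A j) := by
          refine ⟨hq.1.jrev hA.1 hja ?_ (by omega) ?_, ?_, ?_, ?_⟩
          · rw [hq.2.2.1, hA.2.2]; exact hE.symm.par (by omega)
          · intro i k hi hk1 hk2 h
            have := hq.mem hi
            rw [h] at this
            exact hwmax k (by omega) (by omega) this
          · rw [jrev_le (by omega)]; exact hq.2.1
          · rw [jrev_gt (by omega)]; congr 1; omega
          · intro i h0 hi
            rcases le_or_gt i c with h | h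
            · rw [jrev_le h]; exact Or.inl (hq.2.2.2 i h0 h)
            · rw [jrev_gt h]
              exact Or.inr ⟨_, by omega, by omega, rfl⟩
        rcases Nat.mod_two_eq_zero_or_one j with hj | hj
        · exact ⟨_, _, _, _, p2, p1, by omega, by omega, by omega⟩
        · exact ⟨_, _, _, _, p1, p2, by omega, by omega, by omega⟩
    exact hbF (hD.sub (Or.inr ⟨a, hwa', le_rfl, hA.2.2⟩))
  · push Not at hex
    have := hb.far (jrev A a q c) (a + 1 + (c - 0)) ⟨hA.1.jrev hq.1 (by omega) ?_ (by omega) ?_, ?_, ?_⟩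
      (by omega)
    · omega
    · rw [hA.2.2, hq.2.2.1]; exact hE.par (by omega)
    · intro i j hi h0 hj h
      have := hq.mem hj
      rw [← h] at this
      have := hex i hi
      tauto
    · rw [jrev_le (by omega)]; exact hA.2.1
    · rw [jrev_gt (by omega)]
      rw [← hq.2.1]; congr 1; omega

/-- A path from `S` of length at most `e` not meeting `x` strictly before its end avoids `F`. -/
theorem avoid (hM : IsMatching G M) (hS : ∀ v ∈ S, ¬ Matched M v) (hb : Base G M S x e N)
    {A : ℕ → V} {l : ℕ} (hA : AP G M A l) (h0 : A 0 ∈ S) (hl : l ≤ e)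
    (hx : ∀ i, i < l → A i ≠ x) : ∀ i, i ≤ l → A i ∉ Fam G M x e N := by
  intro i
  induction i using Nat.strong_induction_on with
  | _ i ih =>
    intro hi hF
    rcases i with _ | i
    · exact fam_S hM hS h0 hF
    · obtain ⟨p, a, q, b, hp, hq, ha, hb', hl⟩ := Desc.fam G M x e N _ hF
      have h1 := ih i (by omega) (by omega)
      have he := entry hM hA (by omega) h1 hF
      have := ear hM hb (A := A) (a := i) ⟨hA.mono (by omega), h0, rfl⟩ he h1 (hx i (by omega)) hF
        ((hA.2 i (by omega)).par (by omega))
        (fun j hj hjF => absurd hjF (ih j (by omega) (by omega))) hq hb'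
      omega

theorem avoid_self (hM : IsMatching G M) (hS : ∀ v ∈ S, ¬ Matched M v) (hb : Base G M S x e N)
    {A : ℕ → V} (hA : SP G M S A e x) : ∀ i, i ≤ e → A i ∉ Fam G M x e N := by
  refine avoid hM hS hb hA.1 hA.2.1 le_rfl ?_
  intro i hi h
  have := hA.1.1 i e (by omega) le_rfl (by rw [h, hA.2.2])
  omega

/-- concatenation of a shortest path to `x` and a path in the family -/
theorem SP.catX (hM : IsMatching G M) (hS : ∀ v ∈ S, ¬ Matched M v) (hb : Base G M S x e N)
    {P q : ℕ → V} {l : ℕ} {v : V} (hP : SP G M S P e x) (hq : XP G M x (Fam G M x e N) q l v) :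
    SP G M S (cat P e q 0) (e + l) v := by
  have hj : P e = q 0 := by rw [hP.2.2, hq.2.1]
  have h1 := hP.1.cat hq.1 (Nat.zero_le l) hj (by have := hb.even; omega) (by
    intro i j hi h0 hj h
    have := hq.2.2.2 j h0 hj
    rw [← h] at this
    exact avoid_self hM hS hb hP i hi this)
  refine ⟨by simpa using h1, ?_, ?_⟩
  · rw [cat_le (by omega)]; exact hP.2.1
  · rw [cat_ge hj (by omega), ← hq.2.2.1]; congr 1; omega

end

theorem run_ (P : ℕ → Prop) (L : ℕ) (h0 : ¬ P 0) (hL : P L) :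
    ∃ k, k < L ∧ ¬ P k ∧ ∀ j, k < j → j ≤ L → P j := by
  induction L with
  | zero => exact absurd hL h0
  | succ L ih =>
    by_cases h : P L
    · obtain ⟨k, h1, h2, h3⟩ := ih h
      refine ⟨k, by omega, h2, fun j hj hjL => ?_⟩
      rcases Nat.lt_or_eq_of_le hjL with h' | h'
      · exact h3 j hj (by omega)
      · rw [h']; exact hL
    · refine ⟨L, by omega, h, fun j hj hjL => ?_⟩
      rw [show j = L + 1 by omega]; exact hL

theorem claim {G : SimpleGraph V} {M : Set (Sym2 V)} {S : Set V}
    (hM : IsMatching G M) (hS : ∀ v ∈ S, ¬ Matched M v) :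
    ∀ (N : ℕ) (x : V) (e : ℕ), Base G M S x e N → ∀ (L : ℕ) (A : ℕ → V) (v : V),
      SP G M S A L v → v ∈ Fam G M x e N →
      ∃ q l, XP G M x (Fam G M x e N) q l v ∧ l % 2 = L % 2 ∧ e + l ≤ L := by
  intro N
  induction N using Nat.strong_induction_on with
  | _ N ihN =>
  intro x e hb L
  induction L using Nat.strong_induction_on with
  | _ L ihL =>
  intro A vL hA hvL
  by_contra hcon
  obtain ⟨P, hP⟩ := hb.ex
  have hee := hb.even
  have hNo := hb.odd
  set F := Fam G M x e N with hF
  obtain ⟨k0, hk0L, hk0F, hrun⟩ := run_ (fun i => A i ∈ F) L (fam_S hM hS hA.2.1)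
    (by simpa [hA.2.2] using hvL)
  have hk0e : k0 % 2 = 0 := entry hM hA.1 hk0L hk0F (hrun _ (by omega) (by omega))
  -- the vertex before the run is not x
  have hk0x : A k0 ≠ x := by
    intro hx
    have h1 := hb.min A k0 (hx ▸ hA.pre hk0L.le) hk0e
    apply hcon
    refine ⟨cat (fun _ => x) 0 A k0, 0 + (L - k0), ⟨(AP.triv G M x).cat hA.1 hk0L.le hx.symm
      (by omega) ?_, ?_, ?_, ?_⟩, by omega, by omega⟩
    · intro i j _ hj1 hj2 h
      have := hA.1.1 k0 j (by omega) hj2 (by rw [hx, h])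
      omega
    · rw [cat_le le_rfl]
    · rw [cat_ge hx.symm (by omega), ← hA.2.2]; congr 1; omega
    · intro i h0 hi
      rw [cat_ge hx.symm (by omega)]
      exact hrun _ (by omega) (by omega)
  -- (*)
  have hstar : ∀ q c, XP G M x F q c (A (k0 + 1)) → c % 2 = 0 → N < k0 + 1 + c := by
    intro q c hq hc
    refine ear hM hb (hA.pre hk0L.le) hk0e hk0F hk0x (hrun (k0 + 1) (by omega) (by omega))
      ((hA.1.2 k0 hk0L).par (by omega)) ?_ hq hc
    intro i hi hiF hi2
    obtain ⟨q, l, h1, h2, h3⟩ := ihL i (by omega) A _ (hA.pre (by omega)) hiF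
    exact ⟨q, l, h1, by omega, h3⟩
  let Slack : ℕ → Prop := fun d => ∃ q l, XP G M x F q l (A d) ∧ l % 2 = d % 2 ∧ e + l + 2 ≤ d
  have hs0 : Slack (k0 + 1) := by
    obtain ⟨p, a, q, b, hp, hq, ha, hb', hl⟩ :=
      Desc.fam G M x e N _ (hrun (k0 + 1) (by omega) (by omega))
    have := hstar q b hq hb'
    exact ⟨p, a, hp, by omega, by omega⟩
  have hsL : ¬ Slack L := by
    rintro ⟨q, l, h1, h2, h3⟩
    exact hcon ⟨q, l, hA.2.2 ▸ h1, h2, by omega⟩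
  obtain ⟨m, hk0m, hmL, hns, hsl⟩ : ∃ m, k0 < m ∧ m + 1 ≤ L ∧ ¬ Slack (m + 1) ∧
      ∀ j, k0 < j → j ≤ m → Slack j := by
    have hex : ∃ d, k0 < d ∧ d ≤ L ∧ ¬ Slack d := ⟨L, hk0L, le_rfl, hsL⟩
    obtain ⟨h1, h2, h3⟩ := Nat.find_spec hex
    have hmin : ∀ j, j < Nat.find hex → k0 < j → Slack j := by
      intro j hj hk
      by_contra h
      exact Nat.find_min hex hj ⟨hk, by omega, h⟩
    set d := Nat.find hex
    have hd : d ≠ k0 + 1 := by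
      intro h; rw [h] at h3; exact h3 hs0
    refine ⟨d - 1, by omega, by omega, ?_, fun j hj hjm => hmin j (by omega) hj⟩
    rwa [show d - 1 + 1 = d by omega]
  obtain ⟨q, lq, hq, hlq, hqle⟩ := hsl m hk0m le_rfl
  have hbF : A m ∈ F := hrun m (by omega) (by omega)
  have hvF : A (m + 1) ∈ F := hrun (m + 1) (by omega) (by omega)
  have hedge := hA.1.2 m (by omega)
  have hvx : A (m + 1) ≠ x := fun h => base_notMem (h ▸ hvF)
  -- v lies on q
  have hon : ∃ j, j ≤ lq ∧ q j = A (m + 1) := by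
    by_contra hno
    push Not at hno
    apply hns
    refine ⟨snoc q lq (A (m + 1)), lq + 1, ⟨hq.1.snoc ?_ hno, ?_, ?_, ?_⟩, by omega, by omega⟩
    · rw [hq.2.2.1]; exact hedge.par (by omega)
    · rw [snoc_le (by omega)]; exact hq.2.1
    · rw [snoc_gt (by omega)]
    · intro i h0 hi
      rcases le_or_gt i lq with h | h
      · rw [snoc_le h]; exact hq.2.2.2 i h0 h
      · rw [snoc_gt h]; exact hvF
  obtain ⟨j0, hj0, hqj0⟩ := hon
  have hj0m : j0 % 2 ≠ (m + 1) % 2 := by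
    intro h
    exact hns ⟨q, j0, hqj0 ▸ hq.pre hj0, h, by omega⟩
  have hj0lt : j0 < lq := by
    rcases Nat.lt_or_eq_of_le hj0 with h | h
    · exact h
    · rw [h, hq.2.2.1] at hqj0
      have := hA.1.1 m (m + 1) (by omega) (by omega) hqj0
      omega
  -- m is even
  have hme : m % 2 = 0 := by
    by_contra hmo
    have h1 := hedge.2.2 (by omega)
    -- the edge after j0 on q is in M iff j0 odd
    have h2 := (hq.1.2 j0 hj0lt).2.2 (by omega)
    rw [hqj0] at h2
    rw [Sym2.eq_swap] at h1
    have h3 := mate_uniq hM h1 h2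
    rw [← hq.2.2.1] at h3
    have h4 := hq.1.1 _ _ le_rfl (by omega) h3
    omega
  have hj0e : j0 % 2 = 0 := by omega
  set v := A (m + 1) with hv
  -- odd distance
  have hodd : ∀ f l, SP G M S f l v → l % 2 = 1 → m + 1 ≤ l := by
    intro f l hf hl
    by_contra hlt
    obtain ⟨q', l', h1, h2, h3⟩ := ihL l (by omega) f v hf hvF
    exact hns ⟨q', l', h1, by omega, by omega⟩
  -- even distance
  have hexe : ∃ l, l % 2 = 0 ∧ ∃ f, SP G M S f l v :=
    ⟨e + j0, by omega, _, SP.catX hM hS hb hP (hqj0 ▸ hq.pre hj0)⟩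
  obtain ⟨ev, hev2, ⟨fe, hfe⟩, hevmin⟩ : ∃ ev, ev % 2 = 0 ∧ (∃ f, SP G M S f ev v) ∧
      ∀ f l, SP G M S f l v → l % 2 = 0 → ev ≤ l :=
    ⟨Nat.find hexe, (Nat.find_spec hexe).1, (Nat.find_spec hexe).2,
      fun f l h1 h2 => Nat.find_min' hexe ⟨h2, f, h1⟩⟩
  have hevj0 : ev ≤ e + j0 := hevmin _ _ (SP.catX hM hS hb hP (hqj0 ▸ hq.pre hj0)) (by omega)
  obtain ⟨q1, l1, hq1, hl1, hel1⟩ := ihL ev (by omega) fe v hfe hvF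
  have hSP1 := SP.catX hM hS hb hP hq1
  have hev : ev = e + l1 := le_antisymm (hevmin _ _ hSP1 (by omega)) hel1
  have hb' : Base G M S v ev (m - 1) :=
    ⟨⟨fe, hfe⟩, hev2, by omega, hevmin, fun f l h1 h2 => by have := hodd f l h1 h2; omega⟩
  -- (**)
  have hss : m + 1 + ev ≤ N + e := by
    obtain ⟨p, a, q, b, hp, hq, ha, hb2, hl⟩ := Desc.fam G M x e N _ hvF
    have h1 : ¬ (e + a + 2 ≤ m + 1) := fun h => hns ⟨p, a, hp, by omega, h⟩
    have h2 := hevmin _ _ (SP.catX hM hS hb hP hq) (by omega)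
    omega
  have ihF := ihN (m - 1) (by omega) v ev hb'
  set F' := Fam G M v ev (m - 1) with hF'
  have hvF' : v ∉ F' := base_notMem
  -- b ∈ F'
  have hbF' : A m ∈ F' := by
    have hD : Desc G M v ev (m - 1) {g | ∃ j, j0 < j ∧ j ≤ lq ∧ q j = g} := by
      rintro g ⟨j, hj1, hj2, rfl⟩
      have p1 : XP G M v {g | ∃ j, j0 < j ∧ j ≤ lq ∧ q j = g} (cat (fun _ => v) 0 q j0)
          (0 + (j - j0)) (q j) := by
        refine ⟨(AP.triv G M v).cat (hq.1.mono hj2) hj1.le hqj0.symm (by omega) ?_, ?_, ?_, ?_⟩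
        · intro i k hi hk1 hk2 h
          have := hq.1.1 j0 k (by omega) (by omega) (by rw [hqj0, h])
          omega
        · rw [cat_le le_rfl]
        · rw [cat_ge (f := fun _ => v) (a := 0) hqj0.symm (by omega)]; congr 1; omega
        · intro i h0 hi
          rw [cat_ge (f := fun _ => v) (a := 0) hqj0.symm (by omega)]
          exact ⟨_, by omega, by omega, rfl⟩
      have p2 : XP G M v {g | ∃ j, j0 < j ∧ j ≤ lq ∧ q j = g} (jrev (fun _ => v) 0 q lq)
          (0 + 1 + (lq - j)) (q j) := by
        refine ⟨(AP.triv G M v).jrev hq.1 hj2 ?_ (by omega) ?_, ?_, ?_, ?_⟩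
        · rw [hq.2.2.1]; exact hedge.symm.par (by omega)
        · intro i k hi hk1 hk2 h
          have := hq.1.1 j0 k (by omega) (by omega) (by rw [hqj0, h])
          omega
        · rw [jrev_le le_rfl]
        · rw [jrev_gt (by omega)]; congr 1; omega
        · intro i h0 hi
          rw [jrev_gt (by omega)]
          exact ⟨_, by omega, by omega, rfl⟩
      rcases Nat.mod_two_eq_zero_or_one j with hj | hj
      · exact ⟨_, _, _, _, p2, p1, by omega, by omega, by omega⟩
      · exact ⟨_, _, _, _, p1, p2, by omega, by omega, by omega⟩
    exact hD.sub ⟨lq, hj0lt, le_rfl, hq.2.2.1⟩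
  -- q1 avoids F'
  have hj1 : P e = q1 0 := by rw [hP.2.2, hq1.2.1]
  have hq1F' : ∀ i, i ≤ l1 → q1 i ∉ F' := by
    intro i hi
    have := avoid_self hM hS hb' (A := cat P e q1 0) (hev ▸ hSP1) (e + i) (by omega)
    rw [cat_ge hj1 (by omega)] at this
    simpa using this
  have hcat : ∀ D q' l' g, F ⊆ D → F' ⊆ D → XP G M v F' q' l' g →
      XP G M x D (cat q1 l1 q' 0) (l1 + l') g := by
    intro D q' l' g hFD hFD' hq'
    have hj : q1 l1 = q' 0 := by rw [hq1.2.2.1, hq'.2.1]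
    have h1 := hq1.1.cat hq'.1 (Nat.zero_le l') hj (by omega) (by
      intro i k hi hk1 hk2 h
      exact hq1F' i hi (h ▸ hq'.2.2.2 k hk1 hk2))
    refine ⟨by simpa using h1, ?_, ?_, ?_⟩
    · rw [cat_le (by omega)]; exact hq1.2.1
    · rw [cat_ge hj (by omega), ← hq'.2.2.1]; congr 1; omega
    · intro i h0 hi
      rcases le_or_gt i l1 with h | h
      · rw [cat_le h]; exact hFD (hq1.2.2.2 i h0 h)
      · rw [cat_ge hj h.le]; exact hFD' (hq'.2.2.2 _ (by omega) (by omega))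
  have hsub : F' ⊆ F := by
    have hD : Desc G M x e N (F ∪ F') := by
      rintro g (hg | hg)
      · obtain ⟨p, a, q, b, hp, hq, h⟩ := Desc.fam G M x e N g hg
        exact ⟨p, a, q, b, hp.mono Set.subset_union_left, hq.mono Set.subset_union_left, h⟩
      · obtain ⟨p, a, q, b, hp, hq, h1, h2, h3⟩ := Desc.fam G M v ev (m - 1) g hg
        exact ⟨_, _, _, _, hcat _ _ _ _ Set.subset_union_left Set.subset_union_right hp,
          hcat _ _ _ _ Set.subset_union_left Set.subset_union_right hq,
          by omega, by omega, by omega⟩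
    exact Set.subset_union_right.trans hD.sub
  -- last run in F'
  obtain ⟨k1, hk1m, hk1F', hrun1⟩ := run_ (fun i => A i ∈ F') m (fam_S hM hS hA.2.1) hbF'
  have hk1e : k1 % 2 = 0 :=
    entry hM (hA.1.mono (show m ≤ L by omega)) hk1m hk1F' (hrun1 _ (by omega) (by omega))
  have hk01 : k0 ≤ k1 := by
    by_contra h
    exact hk0F (hsub (hrun1 k0 (by omega) (by omega)))
  -- the reversed path from v to u1
  have hrev : XP G M v F' (jrev (fun _ => v) 0 A m) (0 + 1 + (m - (k1 + 1))) (A (k1 + 1)) := by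
    refine ⟨(AP.triv G M v).jrev (hA.1.mono (by omega)) (by omega) ?_ (by omega) ?_, ?_, ?_, ?_⟩
    · exact hedge.symm.par (by omega)
    · intro i k hi hk1 hk2 h
      have := hA.1.1 (m + 1) k (by omega) (by omega) h
      omega
    · rw [jrev_le le_rfl]
    · rw [jrev_gt (by omega)]; congr 1; omega
    · intro i h0 hi
      rw [jrev_gt (by omega)]
      exact hrun1 _ (by omega) (by omega)
  rcases Nat.eq_or_lt_of_le hk01 with h01 | h01
  · subst h01
    have := hstar _ _ (hcat F _ _ _ le_rfl hsub hrev) (by omega)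
    omega
  · obtain ⟨q2, l2, hq2, hl2, hle2⟩ := hsl k1 h01 (by omega)
    have hA2 := SP.catX hM hS hb hP hq2
    have hk1v : A k1 ≠ v := by
      intro h
      have := hA.1.1 k1 (m + 1) (by omega) (by omega) h
      omega
    have := ear hM hb' hA2 (by omega) hk1F' hk1v (hrun1 (k1 + 1) (by omega) (by omega))
      ((hA.1.2 k1 (by omega)).par (by omega)) (by
        intro i hi hiF hi2
        obtain ⟨q, l, h1, h2, h3⟩ := ihF i _ _ (hA2.pre hi) hiF
        exact ⟨q, l, h1, by omega, h3⟩) hrev (by omega)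
    omega

theorem disj_aux {G : SimpleGraph V} {M : Set (Sym2 V)} {S : Set V}
    (hM : IsMatching G M) (hS : ∀ v ∈ S, ¬ Matched M v) {N ex ey : ℕ} {x y : V}
    (hx : Base G M S x ex N) (hy : Base G M S y ey N) (hne : x ≠ y) (hle : ex ≤ ey)
    (hexN : ex ≤ N) {z : V} (hzx : z ∈ Fam G M x ex N) (hzy : z ∈ Fam G M y ey N) : False := by
  have hxe := hx.even
  have hye := hy.even
  obtain ⟨P, hP⟩ := hx.ex
  obtain ⟨Q, hQ⟩ := hy.ex
  -- minimal odd path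
  have hex : ∃ l, l % 2 = 1 ∧ ∃ f w, XP G M x (Fam G M x ex N) f l w ∧ w ∈ Fam G M x ex N ∧
      w ∈ Fam G M y ey N := by
    obtain ⟨p, a, q, b, hp, hq, ha, hb2, hl⟩ := Desc.fam G M x ex N _ hzx
    exact ⟨a, ha, p, z, hp, hzx, hzy⟩
  obtain ⟨hl2, f, w, hf, hwx, hwy⟩ := Nat.find_spec hex
  have hmin := fun l h => Nat.find_min' hex (m := l) h
  set l := Nat.find hex
  have hyx : y ∉ Fam G M x ex N := by
    intro h
    obtain ⟨p, a, q, b, hp, hq, ha, hb2, hl⟩ := Desc.fam G M x ex N _ h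
    have := hy.far _ _ (SP.catX hM hS hx hP hp) (by omega)
    omega
  have hPy : ∀ i, i ≤ ex → P i ≠ y := by
    intro i hi h
    rcases Nat.mod_two_eq_zero_or_one i with h2 | h2
    · have := hy.min P i (h ▸ hP.pre hi) h2
      have : i = ex := by omega
      subst this
      exact hne (hP.2.2.symm.trans h)
    · have := hy.far P i (h ▸ hP.pre hi) h2
      omega
  have hPF := avoid hM hS hy hP.1 hP.2.1 hle (fun i hi => hPy i hi.le)
  have hR := SP.catX hM hS hx hP hf
  have hj : P ex = f 0 := by rw [hP.2.2, hf.2.1]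
  -- the path meets F(y) only at its end
  have honly : ∀ i, i < l → f i ∉ Fam G M y ey N := by
    intro i
    induction i using Nat.strong_induction_on with
    | _ i ih =>
      intro hi h
      rcases i with _ | i
      · exact hPF ex le_rfl (hj ▸ h)
      · have h2 := entry hM hf.1 (by omega) (ih i (by omega) (by omega)) h
        have := hmin (i + 1) ⟨by omega, f, _, hf.pre hi.le, hf.2.2.2 _ (by omega) (by omega), h⟩
        omega
  obtain ⟨p, a, q, b, hp, hq, ha, hb2, hl⟩ := Desc.fam G M y ey N _ hwy
  have hwe : Edg G M 0 (f (l - 1)) w := by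
    have := hf.1.2 (l - 1) (by omega)
    rw [show l - 1 + 1 = l by omega, hf.2.2.1] at this
    exact this.par (by omega)
  have hfy : ∀ i, i ≤ l → f i ≠ y := by
    intro i hi h
    rcases hf.mem hi with h' | h'
    · exact hne (h'.symm.trans h)
    · exact hyx (h ▸ h')
  have hRl : cat P ex f 0 (ex + (l - 1)) = f (l - 1) := by
    rw [cat_ge hj (by omega)]; congr 1; omega
  have hear := ear hM hy (hRl ▸ hR.pre (show ex + (l - 1) ≤ ex + l by omega)) (by omega)
    (honly _ (by omega)) (hfy _ (by omega)) hwy hwe (by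
      intro i hi hiF
      exfalso
      rcases le_or_gt i ex with h | h
      · rw [cat_le h] at hiF; exact hPF i h hiF
      · rw [cat_ge hj h.le] at hiF; exact honly _ (by omega) hiF) hq hb2
  obtain ⟨q', l', h1, h2, h3⟩ := claim hM hS N x ex hx _ _ _ (SP.catX hM hS hy hQ hp) hwx
  have := hmin l' ⟨by omega, q', w, h1, hwx, hwy⟩
  omega

/-! Translation between lists and functions. -/

theorem list_to_fun {G : SimpleGraph V} {M : Set (Sym2 V)} {x y : V} {p : List V}
    (h : IsAltPathFrom G M x y p) :
    ∃ f, AP G M f (pathLen p) ∧ f 0 = x ∧ f (pathLen p) = y ∧ ∀ i, i ≤ pathLen p → f i ∈ p := by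
  obtain ⟨⟨hne, hch, hnd, halt⟩, hh, hl⟩ := h
  have hpos : 0 < p.length := List.length_pos_iff.2 hne
  have hlen : p.length = pathLen p + 1 := by unfold pathLen; omega
  have hget : ∀ i (hi : i < p.length), p.getD i x = p[i] := fun i hi => by simp [hi]
  refine ⟨fun i => p.getD i x, ⟨?_, ?_⟩, ?_, ?_, ?_⟩
  · intro i j hi hj hij
    simp only [hget i (by omega), hget j (by omega)] at hij
    exact (List.Nodup.getElem_inj_iff hnd).1 hij
  · intro i hi
    simp only [hget i (by omega), hget (i + 1) (by omega)]
    exact ⟨List.isChain_iff_getElem.1 hch i (by omega), halt i (by omega)⟩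
  · simp only [hget 0 hpos]
    rw [List.head?_eq_getElem?, List.getElem?_eq_getElem hpos] at hh
    exact Option.some.inj hh
  · simp only [hget _ (show pathLen p < p.length by omega)]
    rw [List.getLast?_eq_getElem?, List.getElem?_eq_getElem (by omega)] at hl
    exact Option.some.inj hl
  · intro i hi
    simp only [hget i (by omega)]
    exact List.getElem_mem _

theorem fun_to_list {G : SimpleGraph V} {M : Set (Sym2 V)} {f : ℕ → V} {l : ℕ}
    (h : AP G M f l) : ∃ p, IsAltPathFrom G M (f 0) (f l) p ∧ pathLen p = l := by
  refine ⟨(List.range (l + 1)).map f, ⟨⟨by simp, ?_, ?_, ?_⟩, ?_, ?_⟩, by simp [pathLen]⟩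
  · refine List.isChain_iff_getElem.2 ?_
    intro i hi
    simp only [List.length_map, List.length_range] at hi
    simpa using (h.2 i (by omega)).1
  · refine List.Nodup.map_on ?_ List.nodup_range
    intro a ha b hb hab
    simp only [List.mem_range] at ha hb
    exact h.1 a b (by omega) (by omega) hab
  · intro i hi
    simp only [List.length_map, List.length_range] at hi
    simpa using (h.2 i (by omega)).2
  · simp [List.head?_eq_getElem?]
  · simp [List.getLast?_eq_getElem?]

theorem tough_base {G : SimpleGraph V} {M : Set (Sym2 V)} {S : Set V} {n : ℕ} {x : V}
    (hx : Tough G M S n x) :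
    ∃ e, Base G M S x e (2 * n + 1) ∧ e ≤ 2 * n ∧ family G M S n x ⊆ Fam G M x e (2 * n + 1) := by
  obtain ⟨hT, -, hH⟩ := hx
  set k := sInf {k : ℕ | x ∈ Tset G M S k ∪ S} with hk
  have hkn : k ≤ n := Nat.sInf_le hT
  have hkm : x ∈ Tset G M S k ∪ S := Nat.sInf_mem (s := {k : ℕ | x ∈ Tset G M S k ∪ S}) ⟨n, hT⟩
  have hfar : ∀ f l, SP G M S f l x → l % 2 = 1 → 2 * n + 1 < l := by
    intro f l hf hl
    by_contra hlt
    obtain ⟨p, hp, hpl⟩ := fun_to_list hf.1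
    rw [hf.2.2] at hp
    exact hH ⟨f 0, hf.2.1, p, hp, by rw [hpl, Nat.odd_iff]; exact hl, by omega⟩
  have hmin : ∀ f l, SP G M S f l x → l % 2 = 0 → 2 * k ≤ l := by
    intro f l hf hl
    by_contra hlt
    have : k ≤ l / 2 := by
      apply Nat.sInf_le
      rcases Nat.eq_zero_or_pos l with h0 | h0
      · right
        have := hf.2.1
        rwa [← hf.2.2, h0]
      · left
        obtain ⟨p, hp, hpl⟩ := fun_to_list hf.1
        rw [hf.2.2] at hp
        refine ⟨⟨f 0, hf.2.1, p, hp, by rw [hpl, Nat.even_iff]; exact hl, by omega, by omega⟩, ?_⟩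
        rintro ⟨s, hs, p', hp', ho, hle⟩
        exact hH ⟨s, hs, p', hp', ho, by omega⟩
    omega
  have hex : ∃ f, SP G M S f (2 * k) x := by
    rcases hkm with h | h
    · obtain ⟨⟨s, hs, p, hp, hev, h2, hle⟩, -⟩ := h
      obtain ⟨f, hf, hf0, hfl, -⟩ := list_to_fun hp
      have hSP : SP G M S f (pathLen p) x := ⟨hf, hf0 ▸ hs, hfl⟩
      have := hmin f _ hSP (Nat.even_iff.1 hev)
      exact ⟨f, by rwa [show 2 * k = pathLen p by omega]⟩
    · have : k = 0 := by
        have := Nat.sInf_le (s := {k : ℕ | x ∈ Tset G M S k ∪ S}) (m := 0) (Or.inr h)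
        omega
      exact ⟨fun _ => x, by rw [this]; exact ⟨AP.triv G M x, h, rfl⟩⟩
  refine ⟨2 * k, ⟨hex, by omega, by omega, hmin, hfar⟩, by omega, ?_⟩
  apply Set.sUnion_subset_sUnion
  intro D hD y hy
  obtain ⟨p, q, hp, hpo, hq, hqe, hpD, hqD, hlen⟩ := hD y hy
  obtain ⟨f, hf, hf0, hfl, hfm⟩ := list_to_fun hp
  obtain ⟨g, hg, hg0, hgl, hgm⟩ := list_to_fun hq
  have hage : age G M S n x = n - k := rfl
  refine ⟨f, _, g, _, ⟨hf, hf0, hfl, ?_⟩, ⟨hg, hg0, hgl, ?_⟩, Nat.odd_iff.1 hpo, Nat.even_iff.1 hqe,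
    by omega⟩
  · intro i h0 hi
    rcases hpD _ (hfm i hi) with h | h
    · have := hf.1 i 0 hi (by omega) (by rw [h, hf0])
      omega
    · exact h
  · intro i h0 hi
    rcases hqD _ (hgm i hi) with h | h
    · have := hg.1 i 0 hi (by omega) (by rw [h, hg0])
      omega
    · exact h

/-- Families of distinct tough vertices are disjoint. -/
theorem families_disjoint (G : SimpleGraph V) (M : Set (Sym2 V)) (S : Set V)
    (hM : IsMatching G M) (hS : ∀ v ∈ S, ¬ Matched M v) (n : ℕ) (x y : V)
    (hx : Tough G M S n x) (hy : Tough G M S n y) (hne : x ≠ y) :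
    family G M S n x ∩ family G M S n y = ∅ := by
  obtain ⟨ex, hbx, hex, hsx⟩ := tough_base hx
  obtain ⟨ey, hby, hey, hsy⟩ := tough_base hy
  rw [Set.eq_empty_iff_forall_notMem]
  rintro z ⟨hzx, hzy⟩
  rcases le_total ex ey with h | h
  · exact disj_aux hM hS hbx hby hne h (by omega) (hsx hzx) (hsy hzy)
  · exact disj_aux hM hS hby hbx hne.symm h (by omega) (hsy hzy) (hsx hzx)

end PaperPM
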